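/- For integers k with 4 ≤ k ≤ 5, the number of k-near-perfect numbers up to x satisfies #N(k;x) ~ (1/6)·x/log x as x → ∞, where the main term comes from numbers n = 6p with p prime, p > 3. -/

import Mathlib

section

open MeasureTheory Filter Topology Set Complex

/-- The Fejér kernel. -/
noncomputable def npK (s : ℝ) : ℝ := Real.sinc (s / 2) ^ 2

noncomputable def npH (t : ℝ) : ℝ := Chebyshev.psi (Real.exp t) * Real.exp (-t)

noncomputable def npG (s : ℂ) : ℂ :=
  (ArithmeticFunction.vonMangoldt.LFunctionResidueClassAux (1 : ZMod 1) s - 1) / s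

lemma npK_cont : Continuous npK := by
  unfold npK
  exact (Real.continuous_sinc.comp (by fun_prop)).pow 2

lemma npK_nonneg (s : ℝ) : 0 ≤ npK s := by unfold npK; positivity

lemma npK_le (s : ℝ) : npK s ≤ 5 * (1 + s ^ 2)⁻¹ := by
  unfold npK
  rw [← div_eq_mul_inv, le_div_iff₀ (by positivity)]
  have h1 : Real.sinc (s/2) ^ 2 ≤ 1 := by
    have := Real.abs_sinc_le_one (s/2)
    rw [← sq_abs]
    nlinarith [abs_nonneg (Real.sinc (s/2))]
  have h2 : Real.sinc (s/2) ^ 2 * s ^ 2 ≤ 4 := by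
    by_cases h : s = 0
    · simp [h]
    · rw [Real.sinc_of_ne_zero (by simpa using h)]
      have : (Real.sin (s / 2) / (s / 2)) ^ 2 * s ^ 2 = 4 * Real.sin (s/2) ^ 2 := by
        field_simp; ring
      rw [this]
      nlinarith [Real.sin_sq_le_one (s/2)]
  nlinarith

lemma npK_int : Integrable npK := by
  refine (integrable_inv_one_add_sq.const_mul 5).mono' npK_cont.aestronglyMeasurable ?_
  refine Eventually.of_forall fun s => ?_
  rw [Real.norm_of_nonneg (npK_nonneg s)]
  exact npK_le s

lemma npK_pos : 0 < ∫ s, npK s := by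
  refine integral_pos_of_integrable_nonneg_nonzero npK_cont npK_int npK_nonneg (x := 0) ?_
  simp [npK]

lemma npK_fourier (s : ℝ) :
    ∫ z in (-1 : ℝ)..1, ((1 - |z| : ℝ) : ℂ) * exp (I * z * s) = (npK s : ℂ) := by
  have hsplit : ∫ z in (-1 : ℝ)..1, ((1 - |z| : ℝ) : ℂ) * exp (I * z * s) =
      (∫ z in (-1 : ℝ)..0, ((1 - |z| : ℝ) : ℂ) * exp (I * z * s)) +
      ∫ z in (0 : ℝ)..1, ((1 - |z| : ℝ) : ℂ) * exp (I * z * s) := by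
    rw [intervalIntegral.integral_add_adjacent_intervals] <;>
    exact Continuous.intervalIntegrable (by fun_prop) _ _
  have hneg : (∫ z in (-1 : ℝ)..0, ((1 - |z| : ℝ) : ℂ) * exp (I * z * s)) =
      ∫ z in (0 : ℝ)..1, ((1 - z : ℝ) : ℂ) * exp (I * z * (-s : ℝ)) := by
    have := intervalIntegral.integral_comp_neg (a := 0) (b := 1)
      (fun z : ℝ => ((1 - |z| : ℝ) : ℂ) * exp (I * z * s))
    rw [neg_zero] at this
    rw [← this]
    refine intervalIntegral.integral_congr fun z hz => ?_
    rw [uIcc_of_le zero_le_one] at hz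
    simp only [abs_neg, abs_of_nonneg hz.1]
    congr 2
    push_cast; ring
  have hpos : (∫ z in (0 : ℝ)..1, ((1 - |z| : ℝ) : ℂ) * exp (I * z * s)) =
      ∫ z in (0 : ℝ)..1, ((1 - z : ℝ) : ℂ) * exp (I * z * s) := by
    refine intervalIntegral.integral_congr fun z hz => ?_
    rw [uIcc_of_le zero_le_one] at hz
    simp only [abs_of_nonneg hz.1]
  have key : ∀ s : ℝ, s ≠ 0 → ∫ z in (0 : ℝ)..1, ((1 - z : ℝ) : ℂ) * exp (I * z * s) =
      exp (I * s) / (I * s) ^ 2 - 1 / (I * s) - 1 / (I * s) ^ 2 := by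
    intro s hs
    have hs' : (s : ℂ) ≠ 0 := by exact_mod_cast hs
    have hd : ∀ z ∈ uIcc (0 : ℝ) 1, HasDerivAt (fun z : ℝ => ((1 - z : ℝ) : ℂ) * exp (I * z * s) / (I * s)
        + exp (I * z * s) / (I * s) ^ 2) (((1 - z : ℝ) : ℂ) * exp (I * z * s)) z := by
      intro z _
      have h1 : HasDerivAt (fun z : ℝ => exp (I * z * s)) (exp (I * z * s) * (I * s)) z := by
        have : HasDerivAt (fun z : ℝ => I * (z : ℂ) * s) (I * s) z := by
          simpa using ((Complex.ofRealCLM.hasDerivAt (x := z)).const_mul I).mul_const (s : ℂ)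
        exact this.cexp
      have h2 : HasDerivAt (fun z : ℝ => ((1 - z : ℝ) : ℂ)) (-1) z := by
        have := (Complex.ofRealCLM.hasDerivAt (x := z)).const_sub 1
        simpa using this
      have hI := I_ne_zero
      refine (((h2.mul h1).div_const (I * s)).add (h1.div_const ((I * s) ^ 2))).congr_deriv ?_
      field_simp
      ring
    rw [intervalIntegral.integral_eq_sub_of_hasDerivAt hd
      (Continuous.intervalIntegrable (by fun_prop) _ _)]
    simp
    ring
  rw [hsplit, hneg, hpos]
  by_cases hs : s = 0
  · subst hs
    have : ∫ z in (0 : ℝ)..1, ((1 - z : ℝ) : ℂ) = 1 / 2 := by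
      rw [intervalIntegral.integral_ofReal]
      rw [intervalIntegral.integral_sub (by simp) (by simp)]
      simp
      norm_num
    simp only [neg_zero, ofReal_zero, mul_zero, exp_zero, mul_one]
    rw [this]
    simp [npK]
    norm_num
  · rw [key s hs, key (-s) (by simpa using hs)]
    have hs' : (s : ℂ) ≠ 0 := by exact_mod_cast hs
    unfold npK
    rw [Real.sinc_of_ne_zero (by simpa using hs)]
    have h3 : (Real.sin (s / 2) / (s / 2)) ^ 2 = (2 - 2 * Real.cos s) / s ^ 2 := by
      have : Real.cos (s/2) ^ 2 = 1 / 2 + Real.cos s / 2 := by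
        rw [Real.cos_sq]; congr 3; ring
      have h4 := Real.sin_sq_add_cos_sq (s/2)
      rw [div_pow, div_eq_div_iff (by positivity) (by positivity)]
      rw [show Real.sin (s/2) ^ 2 = 1 - Real.cos (s/2) ^ 2 by linarith, this]
      ring
    rw [h3]
    push_cast
    rw [Complex.cos]
    have e1 : I * -(s : ℂ) = -s * I := by ring
    have e2 : I * (s : ℂ) = s * I := by ring
    rw [e1, e2]
    field_simp
    have : (I : ℂ) ^ 2 = -1 := I_sq
    simp only [this]
    ring_nf

end

section

open MeasureTheory Filter Topology Set Complex

lemma npH_nonneg (t : ℝ) : 0 ≤ npH t :=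
  mul_nonneg (Chebyshev.psi_nonneg _) (Real.exp_pos _).le

lemma npH_le (t : ℝ) : npH t ≤ Real.log 4 + 4 := by
  unfold npH
  have := Chebyshev.psi_le_const_mul_self (Real.exp_pos t).le
  calc _ ≤ (Real.log 4 + 4) * Real.exp t * Real.exp (-t) := by gcongr
    _ = _ := by rw [mul_assoc, ← Real.exp_add]; simp

lemma npH_mono {t t' : ℝ} (h : t ≤ t') : npH t ≤ npH t' * Real.exp (t' - t) := by
  unfold npH
  rw [mul_assoc, ← Real.exp_add, show -t' + (t' - t) = -t by ring]
  have := Chebyshev.psi_mono (Real.exp_le_exp.mpr h)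
  gcongr

lemma npH_meas : Measurable npH :=
  (Chebyshev.psi_mono.measurable.comp Real.measurable_exp).mul (by fun_prop)

lemma npH_neg {t : ℝ} (h : t ≤ 0) : npH t = 0 := by
  unfold npH
  rw [Chebyshev.psi_eq_zero_of_le_one (by simpa using h), zero_mul]

lemma npLSeries_eq {s : ℂ} (hs : 1 < s.re) :
    LSeries (fun n => ((ArithmeticFunction.vonMangoldt n : ℝ) : ℂ)) s =
      s * ∫ t in Ioi (0 : ℝ), (npH t : ℂ) * exp (-(s - 1) * t) := by
  have hsum : ∀ x : ℝ, ∑ k ∈ Finset.Icc 1 ⌊x⌋₊, ArithmeticFunction.vonMangoldt k =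
      Chebyshev.psi x := by
    intro x
    rw [Chebyshev.psi_eq_sum_Icc, ← Finset.add_sum_Ioc_eq_sum_Icc (Nat.zero_le _)]
    simp
    rfl
  rw [LSeries_eq_mul_integral_of_nonneg (ArithmeticFunction.vonMangoldt) zero_le_one hs ?_
    (fun n => ArithmeticFunction.vonMangoldt_nonneg)]
  · congr 1
    have himg : Ioi (1 : ℝ) = Real.exp '' Ioi 0 := by
      ext x
      simp only [mem_Ioi, mem_image]
      constructor
      · intro hx
        exact ⟨Real.log x, Real.log_pos hx, Real.exp_log (by linarith)⟩
      · rintro ⟨t, ht, rfl⟩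
        simpa using ht
    rw [himg, integral_image_eq_integral_abs_deriv_smul measurableSet_Ioi
      (fun t _ => (Real.hasDerivAt_exp t).hasDerivWithinAt) (Real.exp_injective.injOn)]
    refine setIntegral_congr_fun measurableSet_Ioi fun t _ => ?_
    rw [← ofReal_sum, hsum, abs_of_pos (Real.exp_pos t), npH, real_smul]
    rw [cpow_def_of_ne_zero (by simp), ← ofReal_log (Real.exp_pos t).le,
      Real.log_exp]
    push_cast
    have : exp (-(s - 1) * t) * exp (-(t : ℂ)) = exp t * exp (t * -(s + 1)) := by
      rw [← exp_add, ← exp_add]; congr 1; ring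
    rw [mul_assoc, mul_comm (exp (-(t : ℂ))), this]
    ring
  · refine Asymptotics.IsBigO.of_bound (Real.log 4 + 4) (Eventually.of_forall fun n => ?_)
    have h1 := hsum n
    rw [Nat.floor_natCast] at h1
    rw [h1, Real.norm_of_nonneg (Chebyshev.psi_nonneg _), Real.rpow_one,
      Real.norm_of_nonneg (by positivity)]
    exact Chebyshev.psi_le_const_mul_self (by positivity)

lemma np_exp_int {a : ℂ} (ha : 0 < a.re) :
    IntegrableOn (fun t : ℝ => exp (-a * t)) (Ioi 0) := by
  exact integrableOn_exp_mul_complex_Ioi (by simpa using ha) 0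

lemma npH_int {a : ℂ} (ha : 0 < a.re) :
    IntegrableOn (fun t : ℝ => (npH t : ℂ) * exp (-a * t)) (Ioi 0) := by
  refine (np_exp_int ha).bdd_mul (c := Real.log 4 + 4) ?_ ?_
  · exact (measurable_ofReal.comp npH_meas).aestronglyMeasurable
  · refine Eventually.of_forall fun t => ?_
    rw [norm_real, Real.norm_of_nonneg (npH_nonneg t)]
    exact npH_le t

lemma npG_laplace {s : ℂ} (hs : 1 < s.re) :
    ∫ t in Ioi (0 : ℝ), ((npH t - 1 : ℝ) : ℂ) * exp (-(s - 1) * t) = npG s := by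
  have ha : 0 < (s - 1).re := by simpa using hs
  have hs0 : s ≠ 0 := by rintro rfl; simp at hs; linarith
  have hs1 : s - 1 ≠ 0 := by intro h; rw [h] at ha; simp at ha
  have h1 := ArithmeticFunction.vonMangoldt.eqOn_LFunctionResidueClassAux
    (a := (1 : ZMod 1)) isUnit_one hs
  have h2 : (fun n => ((ArithmeticFunction.vonMangoldt.residueClass (1 : ZMod 1) n : ℝ):ℂ)) =
      fun n => ((ArithmeticFunction.vonMangoldt n : ℝ):ℂ) := by
    ext n
    simp [ArithmeticFunction.vonMangoldt.residueClass, Subsingleton.elim _ (1 : ZMod 1)]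
  unfold npG
  rw [h1]
  simp only
  rw [h2, npLSeries_eq hs]
  simp only [ofReal_sub, ofReal_one, sub_mul, one_mul]
  rw [integral_sub]
  · rw [integral_exp_mul_complex_Ioi (by simpa using ha)]
    generalize ∫ t in Ioi (0 : ℝ), (npH t : ℂ) * exp (-(s - 1) * t) = J
    have h3 : -(exp (-(s - 1) * (0 : ℝ))) / (-(s - 1)) = 1 / (s - 1) := by
      rw [neg_div_neg_eq]; simp
    rw [h3]
    simp only [Nat.totient_one, Nat.cast_one, inv_one]
    field_simp
    ring
  · exact npH_int ha
  · exact np_exp_int ha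

lemma npG_cont : ContinuousOn npG {s | 1 ≤ s.re} := by
  unfold npG
  refine ((ArithmeticFunction.vonMangoldt.continuousOn_LFunctionResidueClassAux _).sub
    continuousOn_const).div continuousOn_id ?_
  rintro s hs rfl
  simp at hs
  linarith

end

section

open MeasureTheory Filter Topology Set Complex

lemma np_fubini (l u : ℝ) {ε : ℝ} (hε : 0 < ε) :
    ∫ z in (-1 : ℝ)..1, ((1 - |z| : ℝ) : ℂ) * exp (I * z * (l * u : ℝ)) * npG (1 + ε + I * (l * z : ℝ)) =
      ∫ t in Ioi (0 : ℝ), (((npH t - 1) * Real.exp (-ε * t) * npK (l * (u - t)) : ℝ) : ℂ) := by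
  have h1 : ∀ z : ℝ, ((1 - |z| : ℝ) : ℂ) * exp (I * z * (l * u : ℝ)) * npG (1 + ε + I * (l * z : ℝ)) =
      ∫ t in Ioi (0 : ℝ), ((1 - |z| : ℝ) : ℂ) * exp (I * z * (l * u : ℝ)) *
        (((npH t - 1 : ℝ) : ℂ) * exp (-((1 + ε + I * (l * z : ℝ)) - 1) * t)) := by
    intro z
    rw [integral_const_mul, npG_laplace]
    simpa using hε
  simp_rw [h1]
  rw [intervalIntegral.integral_of_le (by norm_num), integral_integral_swap]
  · refine setIntegral_congr_fun measurableSet_Ioi fun t _ => ?_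
    have h2 := npK_fourier (l * (u - t))
    rw [intervalIntegral.integral_of_le (by norm_num)] at h2
    push_cast
    rw [← h2, ← integral_const_mul]
    refine integral_congr_ae (Eventually.of_forall fun z => ?_)
    simp only
    have : exp (I * z * (l * (u - t) : ℝ)) * exp (-ε * t) =
      exp (I * z * (l * u : ℝ)) * exp (-((1 + ε + I * (l * z : ℝ)) - 1) * t) := by
      rw [← exp_add, ← exp_add]; congr 1; push_cast; ring
    push_cast at this ⊢
    linear_combination (1 - ((|z| : ℝ) : ℂ)) * (npH t - 1) * (-this)
  · have hb : Integrable (fun p : ℝ × ℝ => (1 : ℝ) * ((Real.log 4 + 5) * Real.exp (-ε * p.2)))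
        ((volume.restrict (Ioc (-1) 1)).prod (volume.restrict (Ioi 0))) := by
      refine Integrable.mul_prod (f := fun _ : ℝ => (1 : ℝ))
        (g := fun t : ℝ => (Real.log 4 + 5) * Real.exp (-ε * t)) ?_ ?_
      · simp
      · exact (integrableOn_exp_mul_Ioi (by simpa using hε) 0).const_mul _
    refine hb.mono' ?_ ?_
    · refine Measurable.aestronglyMeasurable ?_
      have := npH_meas
      simp only [Function.uncurry_def]
      fun_prop
    · rw [Measure.prod_restrict]
      refine (ae_restrict_iff' (measurableSet_Ioc.prod measurableSet_Ioi)).mpr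
        (Eventually.of_forall fun p hp => ?_)
      obtain ⟨⟨hz1, hz2⟩, ht⟩ := hp
      simp only [Function.uncurry_def, norm_mul, norm_real, Complex.norm_exp]
      have e1 : (I * p.1 * (l * u : ℝ)).re = 0 := by simp
      have e2 : (-((1 + ε + I * (l * p.1 : ℝ)) - 1) * p.2).re = -ε * p.2 := by simp
      rw [e1, e2, Real.exp_zero, mul_one]
      have a1 : |p.1| ≤ 1 := abs_le.mpr ⟨by linarith, hz2⟩
      have b1 : ‖1 - |p.1|‖ ≤ 1 := by
        rw [Real.norm_of_nonneg (by linarith)]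
        linarith [abs_nonneg p.1]
      have b2 : ‖npH p.2 - 1‖ ≤ Real.log 4 + 5 := by
        rw [Real.norm_eq_abs, abs_le]
        have := npH_nonneg p.2
        have := npH_le p.2
        have := Real.log_nonneg (show (1 : ℝ) ≤ 4 by norm_num)
        constructor <;> linarith
      gcongr

lemma np_limit_identity {l : ℝ} (hl : 0 < l) (u : ℝ) :
    ∫ z in (-1 : ℝ)..1, ((1 - |z| : ℝ) : ℂ) * exp (I * z * (l * u : ℝ)) * npG (1 + I * (l * z : ℝ)) =
      ∫ t in Ioi (0 : ℝ), (((npH t - 1) * npK (l * (u - t)) : ℝ) : ℂ) := by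
  have hL : Tendsto (fun ε : ℝ => ∫ z in (-1 : ℝ)..1, ((1 - |z| : ℝ) : ℂ) * exp (I * z * (l * u : ℝ)) *
      npG (1 + ε + I * (l * z : ℝ))) (𝓝[>] 0) (𝓝 (∫ z in (-1 : ℝ)..1, ((1 - |z| : ℝ) : ℂ) *
        exp (I * z * (l * u : ℝ)) * npG (1 + I * (l * z : ℝ)))) := by
    have hc : ContinuousOn (fun p : ℝ × ℝ => ((1 - |p.2| : ℝ) : ℂ) * exp (I * p.2 * (l * u : ℝ)) *
      npG (1 + p.1 + I * (l * p.2 : ℝ))) (Icc 0 1 ×ˢ Icc (-1) 1) := by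
      refine ContinuousOn.mul (Continuous.continuousOn (by fun_prop)) ?_
      refine npG_cont.comp (Continuous.continuousOn (by fun_prop)) ?_
      rintro ⟨e, z⟩ ⟨⟨h1, _⟩, _⟩
      simpa using h1
    obtain ⟨C, hC⟩ := (isCompact_Icc.prod isCompact_Icc).exists_bound_of_continuousOn hc
    have hmem : ∀ᶠ ε : ℝ in 𝓝[>] 0, ε ∈ Icc (0 : ℝ) 1 := by
      filter_upwards [Ioc_mem_nhdsGT (show (0 : ℝ) < 1 by norm_num)] with ε h
      exact ⟨h.1.le, h.2⟩
    refine intervalIntegral.tendsto_integral_filter_of_dominated_convergence (fun _ => C) ?_ ?_ ?_ ?_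
    · filter_upwards [hmem] with ε hε
      rw [uIoc_of_le (by norm_num)]
      refine ContinuousOn.aestronglyMeasurable ?_ measurableSet_Ioc
      refine hc.comp (f := fun z : ℝ => (ε, z)) (Continuous.continuousOn (by fun_prop)) ?_
      intro z hz
      exact ⟨hε, hz.1.le, hz.2⟩
    · filter_upwards [hmem] with ε hε
      refine Eventually.of_forall fun z hz => ?_
      rw [uIoc_of_le (by norm_num)] at hz
      exact hC (ε, z) ⟨hε, hz.1.le, hz.2⟩
    · simp
    · refine Eventually.of_forall fun z hz => ?_
      rw [uIoc_of_le (by norm_num)] at hz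
      have h1 := hc (0, z) ⟨⟨le_rfl, zero_le_one⟩, hz.1.le, hz.2⟩
      have h2 : Tendsto (fun ε : ℝ => (ε, z)) (𝓝[>] 0) (𝓝[Icc 0 1 ×ˢ Icc (-1) 1] ((0 : ℝ), z)) := by
        refine tendsto_nhdsWithin_iff.mpr ⟨?_, ?_⟩
        · refine Tendsto.mono_left ?_ nhdsWithin_le_nhds
          exact (Continuous.tendsto (by fun_prop : Continuous fun ε : ℝ => (ε, z)) 0)
        · filter_upwards [hmem] with ε hε
          exact ⟨hε, hz.1.le, hz.2⟩
      have h3 := h1.tendsto.comp h2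
      simpa [Function.comp_def] using h3
  have hR : Tendsto (fun ε : ℝ => ∫ t in Ioi (0 : ℝ),
      (((npH t - 1) * Real.exp (-ε * t) * npK (l * (u - t)) : ℝ) : ℂ)) (𝓝[>] 0)
      (𝓝 (∫ t in Ioi (0 : ℝ), (((npH t - 1) * npK (l * (u - t)) : ℝ) : ℂ))) := by
    have hm := npH_meas
    have hm2 := npK_cont.measurable
    have hKi : Integrable (fun t => npK (l * (u - t))) :=
      (npK_int.comp_mul_left' hl.ne').comp_sub_left u
    refine tendsto_integral_filter_of_dominated_convergence
      (fun t => (Real.log 4 + 5) * npK (l * (u - t))) ?_ ?_ ?_ ?_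
    · exact Eventually.of_forall fun ε => Measurable.aestronglyMeasurable (by fun_prop)
    · filter_upwards [self_mem_nhdsWithin] with ε hε
      refine (ae_restrict_iff' measurableSet_Ioi).mpr (Eventually.of_forall fun t ht => ?_)
      rw [norm_real, norm_mul, norm_mul, Real.norm_of_nonneg (npK_nonneg _),
        Real.norm_of_nonneg (Real.exp_pos _).le]
      have hε' : 0 < ε := hε
      have ht' : 0 < t := ht
      have b2 : ‖npH t - 1‖ ≤ Real.log 4 + 5 := by
        rw [Real.norm_eq_abs, abs_le]
        have := npH_nonneg t
        have := npH_le t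
        have := Real.log_nonneg (show (1 : ℝ) ≤ 4 by norm_num)
        constructor <;> linarith
      have b3 : Real.exp (-ε * t) ≤ 1 := Real.exp_le_one_iff.mpr (by nlinarith)
      have := npK_nonneg (l * (u - t))
      calc ‖npH t - 1‖ * Real.exp (-ε * t) * npK (l * (u - t))
          ≤ (Real.log 4 + 5) * 1 * npK (l * (u - t)) := by gcongr
        _ = _ := by ring
    · exact (hKi.const_mul _).integrableOn
    · refine Eventually.of_forall fun t => ?_
      have : Continuous fun ε : ℝ => (((npH t - 1) * Real.exp (-ε * t) * npK (l * (u - t)) : ℝ) : ℂ) := by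
        fun_prop
      have h2 := (this.tendsto 0).mono_left (nhdsWithin_le_nhds (s := Ioi 0))
      simpa using h2
  refine tendsto_nhds_unique hL (hR.congr' ?_)
  filter_upwards [self_mem_nhdsWithin] with ε hε
  exact (np_fubini l u hε).symm

lemma np_tendsto_zero {l : ℝ} (hl : 0 < l) :
    Tendsto (fun u => ∫ t in Ioi (0 : ℝ), (npH t - 1) * npK (l * (u - t))) atTop (𝓝 0) := by
  have h1 := Real.tendsto_integral_exp_smul_cocompact
    ((Ioc (-1 : ℝ) 1).indicator fun z : ℝ => ((1 - |z| : ℝ) : ℂ) * npG (1 + I * (l * z : ℝ)))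
  have h2 : Tendsto (fun u : ℝ => -(l * u / (2 * Real.pi))) atTop (cocompact ℝ) := by
    refine Tendsto.mono_right ?_ atBot_le_cocompact
    refine tendsto_neg_atTop_atBot.comp ?_
    exact (tendsto_id.const_mul_atTop hl).atTop_div_const (by positivity)
  have h3 := h1.comp h2
  rw [← Complex.ofReal_zero] at h3
  rw [← Filter.tendsto_ofReal_iff]
  refine h3.congr fun u => ?_
  rw [← integral_complex_ofReal, ← np_limit_identity hl, intervalIntegral.integral_of_le (by norm_num),
    ← integral_indicator measurableSet_Ioc]
  refine integral_congr_ae (Eventually.of_forall fun z => ?_)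
  simp only [indicator_apply]
  split_ifs
  · rw [Circle.smul_def, Real.fourierChar_apply, smul_eq_mul]
    have : 2 * Real.pi * -(z * -(l * u / (2 * Real.pi))) = z * (l * u) := by
      field_simp
    rw [this]
    have e : ((z * (l * u) : ℝ) : ℂ) * I = I * z * (l * u : ℝ) := by push_cast; ring
    rw [e]
    ring
  · simp

end

section

open MeasureTheory Filter Topology Set Complex

lemma np_conv_int (l u : ℝ) : Integrable (fun s => npH (u - s / l) * npK s) := by
  have hm := npH_meas
  refine npK_int.bdd_mul (c := Real.log 4 + 4) (Measurable.aestronglyMeasurable (by fun_prop)) ?_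
  refine Eventually.of_forall fun t => ?_
  rw [Real.norm_of_nonneg (npH_nonneg _)]
  exact npH_le _

lemma np_conv {l : ℝ} (hl : 0 < l) :
    Tendsto (fun u => ∫ s, npH (u - s / l) * npK s) atTop (𝓝 (∫ s, npK s)) := by
  have hKl : Integrable (fun x => npK (l * x)) := npK_int.comp_mul_left' hl.ne'
  have h2 : Tendsto (fun u => ∫ t in Ioi (0 : ℝ), npK (l * (u - t))) atTop
      (𝓝 (l⁻¹ * ∫ s, npK s)) := by
    have ha : AECover volume atTop (fun u : ℝ => Iio u) := aecover_Iio tendsto_id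
    have h3 := ha.integral_tendsto_of_countably_generated hKl
    rw [Measure.integral_comp_mul_left, abs_of_pos (inv_pos.mpr hl), smul_eq_mul] at h3
    refine h3.congr fun u => ?_
    rw [← integral_indicator measurableSet_Iio, ← integral_indicator measurableSet_Ioi,
      ← integral_sub_left_eq_self _ _ u]
    refine integral_congr_ae (Eventually.of_forall fun t => ?_)
    simp [indicator_apply]
  have h1 := ((np_tendsto_zero hl).add h2).const_mul l
  rw [zero_add, ← mul_assoc, mul_inv_cancel₀ hl.ne', one_mul] at h1
  refine h1.congr fun u => ?_
  have hKu : Integrable (fun t => npK (l * (u - t))) := hKl.comp_sub_left u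
  have hprod : Integrable (fun t => npH t * npK (l * (u - t))) := by
    refine hKu.bdd_mul (c := Real.log 4 + 4) npH_meas.aestronglyMeasurable ?_
    refine Eventually.of_forall fun t => ?_
    rw [Real.norm_of_nonneg (npH_nonneg _)]
    exact npH_le _
  have e1 : ∫ t in Ioi (0 : ℝ), (npH t - 1) * npK (l * (u - t)) =
      (∫ t, npH t * npK (l * (u - t))) - ∫ t in Ioi (0 : ℝ), npK (l * (u - t)) := by
    simp_rw [sub_mul, one_mul]
    rw [integral_sub hprod.integrableOn hKu.integrableOn]
    congr 1
    refine setIntegral_eq_integral_of_forall_compl_eq_zero fun t ht => ?_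
    rw [npH_neg (by simpa using ht), zero_mul]
  have e2 : ∫ t, npH t * npK (l * (u - t)) = l⁻¹ * ∫ s, npH (u - s / l) * npK s := by
    have h4 := Measure.integral_comp_mul_left (fun s => npH (u - s / l) * npK s) l
    rw [abs_of_pos (inv_pos.mpr hl), smul_eq_mul] at h4
    rw [← h4, ← integral_sub_left_eq_self _ _ u]
    refine integral_congr_ae (Eventually.of_forall fun t => ?_)
    simp only
    rw [mul_div_cancel_left₀ _ hl.ne', sub_sub_cancel]
  rw [e1, e2, sub_add_cancel, ← mul_assoc, mul_inv_cancel₀ hl.ne', one_mul]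

lemma np_bounds {η : ℝ} (h0 : 0 < η) (h1 : η < 1) :
    (∀ᶠ u in atTop, npH u ≤ Real.exp (2 * η) * (1 + η) / (1 - η)) ∧
    (∀ᶠ u in atTop, Real.exp (-(2 * η)) * (1 - η - (Real.log 4 + 4) * η) ≤ npH u) := by
  set c := ∫ s, npK s with hc
  have hcpos : 0 < c := npK_pos
  obtain ⟨R, hR0, hR⟩ : ∃ R : ℝ, 0 < R ∧ (1 - η) * c < ∫ s in Icc (-R) R, npK s := by
    have h := intervalIntegral_tendsto_integral npK_int tendsto_neg_atTop_atBot tendsto_id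
    have h2 := (h.eventually (lt_mem_nhds (show (1 - η) * c < c by nlinarith))).and
      (eventually_gt_atTop 0)
    obtain ⟨R, hR, hR0⟩ := h2.exists
    refine ⟨R, hR0, ?_⟩
    simp only [id] at hR
    rwa [intervalIntegral.integral_of_le (by linarith), ← integral_Icc_eq_integral_Ioc] at hR
  set l := R / η with hl
  have hlpos : 0 < l := by positivity
  have hconv := np_conv hlpos
  rw [← hc] at hconv
  have hsl : ∀ s ∈ Icc (-R) R, -η ≤ s / l ∧ s / l ≤ η := by
    intro s hs
    have : R / l = η := by rw [hl]; field_simp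
    constructor
    · rw [← this, ← neg_div]; gcongr; exact hs.1
    · rw [← this]; gcongr; exact hs.2
  have hKR : Integrable npK (volume.restrict (Icc (-R) R)) := npK_int.integrableOn
  constructor
  · have hev := (tendsto_atTop_add_const_right atTop η tendsto_id).eventually
      (hconv.eventually (gt_mem_nhds (show c < (1 + η) * c by nlinarith)))
    filter_upwards [hev] with u hu
    simp only [id] at hu
    have : npH u * Real.exp (-(2 * η)) * ∫ s in Icc (-R) R, npK s ≤
        ∫ s, npH (u + η - s / l) * npK s := by
      calc _ = ∫ s in Icc (-R) R, npH u * Real.exp (-(2 * η)) * npK s := by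
              rw [integral_const_mul]
        _ ≤ ∫ s in Icc (-R) R, npH (u + η - s / l) * npK s := by
              refine setIntegral_mono_on (hKR.const_mul _) (np_conv_int l _).integrableOn
                measurableSet_Icc fun s hs => ?_
              obtain ⟨a1, a2⟩ := hsl s hs
              refine mul_le_mul_of_nonneg_right ?_ (npK_nonneg s)
              have b1 := npH_mono (show u ≤ u + η - s / l by linarith)
              have b2 : Real.exp (u + η - s / l - u) ≤ Real.exp (2 * η) :=
                Real.exp_le_exp.mpr (by linarith)
              have b3 := npH_nonneg (u + η - s / l)
              rw [Real.exp_neg, ← div_eq_mul_inv, div_le_iff₀ (Real.exp_pos _)]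
              exact b1.trans (by gcongr)
        _ ≤ _ := by
              refine setIntegral_le_integral (np_conv_int l _) (Eventually.of_forall fun s => ?_)
              exact mul_nonneg (npH_nonneg _) (npK_nonneg _)
    have h3 : npH u * Real.exp (-(2 * η)) * ((1 - η) * c) ≤ (1 + η) * c := by
      refine le_trans ?_ (this.trans hu.le)
      have := npH_nonneg u
      gcongr
    rw [le_div_iff₀ (by linarith)]
    rw [Real.exp_neg] at h3
    have h4 : npH u * (Real.exp (2 * η))⁻¹ * (1 - η) ≤ 1 + η := by
      refine le_of_mul_le_mul_right ?_ hcpos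
      linarith
    have hE := Real.exp_pos (2 * η)
    calc npH u * (1 - η) = Real.exp (2 * η) * (npH u * (Real.exp (2 * η))⁻¹ * (1 - η)) := by
          field_simp
      _ ≤ _ := by gcongr
  · have hev := (tendsto_atTop_add_const_right atTop (-η) tendsto_id).eventually
      (hconv.eventually (lt_mem_nhds (show (1 - η) * c < c by nlinarith)))
    filter_upwards [hev] with u hu
    simp only [id] at hu
    have hM : 0 < Real.log 4 + 4 := by
      have := Real.log_nonneg (show (1 : ℝ) ≤ 4 by norm_num)
      linarith
    have hsplit := integral_add_compl (measurableSet_Icc (a := -R) (b := R)) (np_conv_int l (u + -η))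
    have hsplit2 := integral_add_compl (measurableSet_Icc (a := -R) (b := R)) npK_int
    have hA : ∫ s in Icc (-R) R, npH (u + -η - s / l) * npK s ≤
        npH u * Real.exp (2 * η) * ∫ s in Icc (-R) R, npK s := by
      rw [← integral_const_mul]
      refine setIntegral_mono_on (np_conv_int l _).integrableOn (hKR.const_mul _)
                measurableSet_Icc fun s hs => ?_
      obtain ⟨a1, a2⟩ := hsl s hs
      refine mul_le_mul_of_nonneg_right ?_ (npK_nonneg s)
      refine (npH_mono (show u + -η - s / l ≤ u by linarith)).trans ?_
      have := npH_nonneg u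
      gcongr
      linarith
    have hB : ∫ s in (Icc (-R) R)ᶜ, npH (u + -η - s / l) * npK s ≤
        (Real.log 4 + 4) * ∫ s in (Icc (-R) R)ᶜ, npK s := by
      rw [← integral_const_mul]
      refine setIntegral_mono_on (np_conv_int l _).integrableOn (npK_int.const_mul _).integrableOn
                measurableSet_Icc.compl fun s hs => ?_
      exact mul_le_mul_of_nonneg_right (npH_le _) (npK_nonneg s)
    have hCc : 0 ≤ ∫ s in (Icc (-R) R)ᶜ, npK s :=
      setIntegral_nonneg measurableSet_Icc.compl fun s _ => npK_nonneg s
    have hu0 := npH_nonneg u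
    have hE := Real.exp_pos (2 * η)
    have hA2 : npH u * Real.exp (2 * η) * ∫ s in Icc (-R) R, npK s ≤
        npH u * Real.exp (2 * η) * c := by
      gcongr
      linarith
    have hB2 : (Real.log 4 + 4) * ∫ s in (Icc (-R) R)ᶜ, npK s ≤ (Real.log 4 + 4) * (η * c) := by
      gcongr
      linarith
    have h4 : 1 - η - (Real.log 4 + 4) * η ≤ npH u * Real.exp (2 * η) := by
      refine le_of_mul_le_mul_right ?_ hcpos
      linarith
    rw [Real.exp_neg, inv_mul_le_iff₀ hE]
    linarith

lemma npH_tendsto : Tendsto npH atTop (𝓝 1) := by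
  rw [tendsto_order]
  constructor
  · intro a ha
    have hc : ContinuousAt (fun η : ℝ => Real.exp (-(2 * η)) * (1 - η - (Real.log 4 + 4) * η)) 0 := by
      fun_prop
    have h1 := hc.tendsto.mono_left (nhdsWithin_le_nhds (s := Ioi 0))
    simp at h1
    obtain ⟨η, ⟨hη, h0⟩, hη1⟩ := ((h1.eventually (lt_mem_nhds ha)).and
      (self_mem_nhdsWithin)).and (Ioo_mem_nhdsGT (show (0 : ℝ) < 1 by norm_num)) |>.exists
    filter_upwards [(np_bounds h0 hη1.2).2] with u hu
    linarith
  · intro a ha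
    have hc : ContinuousAt (fun η : ℝ => Real.exp (2 * η) * (1 + η) / (1 - η)) 0 := by
      refine ContinuousAt.div (by fun_prop) (by fun_prop) (by norm_num)
    have h1 := hc.tendsto.mono_left (nhdsWithin_le_nhds (s := Ioi 0))
    simp at h1
    obtain ⟨η, ⟨hη, h0⟩, hη1⟩ := ((h1.eventually (gt_mem_nhds ha)).and
      (self_mem_nhdsWithin)).and (Ioo_mem_nhdsGT (show (0 : ℝ) < 1 by norm_num)) |>.exists
    filter_upwards [(np_bounds h0 hη1.2).1] with u hu
    linarith

lemma np_psi : Tendsto (fun x => Chebyshev.psi x / x) atTop (𝓝 1) := by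
  refine (npH_tendsto.comp Real.tendsto_log_atTop).congr' ?_
  filter_upwards [eventually_gt_atTop 0] with x hx
  simp only [Function.comp, npH]
  rw [Real.exp_neg, Real.exp_log hx, div_eq_mul_inv]

lemma np_theta : Tendsto (fun x => Chebyshev.theta x / x) atTop (𝓝 1) := by
  have h1 : Tendsto (fun x => (Chebyshev.psi - Chebyshev.theta) x / x) atTop (𝓝 0) := by
    refine (Chebyshev.isBigO_psi_sub_theta_sqrt.trans_isLittleO ?_).tendsto_div_nhds_zero
    refine Asymptotics.isLittleO_iff_tendsto' ?_ |>.mpr ?_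
    · filter_upwards [eventually_gt_atTop 0] with x hx h
      exact absurd h hx.ne'
    · refine (Real.tendsto_sqrt_atTop.inv_tendsto_atTop).congr fun x => ?_
      simp [Real.sqrt_div_self]
  have h2 := np_psi.sub h1
  rw [sub_zero] at h2
  refine h2.congr fun x => ?_
  simp only [Pi.sub_apply]
  ring

/-- The prime number theorem. -/
theorem np_pnt : Tendsto (fun x : ℝ => (Nat.primeCounting ⌊x⌋₊ : ℝ) * Real.log x / x) atTop (𝓝 1) := by
  have h1 := Chebyshev.primeCounting_sub_theta_div_log_isBigO
  have h2 : (fun x : ℝ => x / Real.log x ^ 2) =o[atTop] fun x => x / Real.log x := by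
    refine Asymptotics.isLittleO_iff_tendsto' (by simp) |>.mpr ?_
    refine Tendsto.congr' (f₁ := fun x ↦ (Real.log x)⁻¹) ?_ Real.tendsto_log_atTop.inv_tendsto_atTop
    filter_upwards [eventually_gt_atTop 1] with x hx
    have := Real.log_pos hx
    field_simp
  have h3 := (h1.trans_isLittleO h2).tendsto_div_nhds_zero
  have h4 := h3.add np_theta
  rw [zero_add] at h4
  refine h4.congr' ?_
  filter_upwards [eventually_gt_atTop 1] with x hx
  have := Real.log_pos hx
  field_simp
  ring

end

section

open Finset

theorem np_deficient_pp {m : ℕ} (h : IsPrimePow m) : ArithmeticFunction.sigma 1 m < 2 * m := by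
  have h1 := h.deficient
  unfold Nat.Deficient at h1
  rw [ArithmeticFunction.sigma_one_apply, Nat.sum_divisors_eq_sum_properDivisors_add_self]
  omega

theorem np_six {m : ℕ} (hm : 0 < m) (ht : m.divisors.card ≤ 5)
    (hs : 2 * m ≤ ArithmeticFunction.sigma 1 m) : m = 6 := by
  have h1 : m ≠ 1 := by
    rintro rfl
    simp at hs
  have hq := Nat.minFac_prime h1
  set q := m.minFac with hqd
  obtain ⟨a, r, hr, hmr⟩ := Nat.exists_eq_pow_mul_and_not_dvd hm.ne' q hq.one_lt.ne'
  have ha : a ≠ 0 := by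
    rintro rfl
    apply hr
    have h5 : q ∣ m := Nat.minFac_dvd m
    rw [pow_zero, one_mul] at hmr
    exact hmr ▸ h5
  have hr0 : r ≠ 0 := by rintro rfl; simp at hr
  have hr1 : r ≠ 1 := by
    rintro rfl
    have : IsPrimePow m := by
      rw [hmr, mul_one]
      exact hq.isPrimePow.pow ha
    have := np_deficient_pp this
    omega
  have hcop : Nat.Coprime (q ^ a) r := Nat.Coprime.pow_left _ ((Nat.Prime.coprime_iff_not_dvd hq).2 hr)
  have hcard : m.divisors.card = (a + 1) * r.divisors.card := by
    rw [hmr, hcop.card_divisors_mul, Nat.divisors_prime_pow hq]; simp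
  have hr2 : 2 ≤ r.divisors.card := by
    have : ({1, r} : Finset ℕ) ⊆ r.divisors := by
      intro y; simp; rintro (rfl | rfl) <;> simp [hr0]
    have h2 := Finset.card_le_card this
    rwa [Finset.card_pair (Ne.symm hr1)] at h2
  have ha1 : a = 1 := by
    by_contra h
    have : 3 ≤ a + 1 := by omega
    nlinarith
  subst ha1
  have hr3 : r.divisors.card = 2 := by omega
  have hrp : r.Prime := by
    rw [Nat.prime_def]
    refine ⟨by omega, fun d hd => ?_⟩
    by_contra hne
    push Not at hne
    have : ({1, d, r} : Finset ℕ) ⊆ r.divisors := by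
      intro y; simp; rintro (rfl | rfl | rfl) <;> simp [hr0, hd]
    have h2 := Finset.card_le_card this
    rw [Finset.card_eq_three.2 ⟨1, d, r, hne.1.symm, Ne.symm hr1, hne.2, rfl⟩] at h2
    omega
  have hsig : ArithmeticFunction.sigma 1 m = (q + 1) * (r + 1) := by
    rw [hmr, ArithmeticFunction.isMultiplicative_sigma.map_mul_of_coprime hcop, pow_one,
      ArithmeticFunction.sigma_one_apply, ArithmeticFunction.sigma_one_apply, hq.sum_divisors,
      hrp.sum_divisors]
    
  rw [pow_one] at hmr
  rw [hsig] at hs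
  have hne : q ≠ r := by
    intro h; apply hr; rw [h]
  have q2 := hq.two_le
  have r2 := hrp.two_le
  rcases Nat.lt_or_ge q 3 with h3 | h3
  · have h6 : q = 2 := by omega
    rw [h6] at hs hmr hne
    rw [hmr] at hs ⊢
    omega
  · rcases Nat.lt_or_ge r 3 with h4 | h4
    · have h6 : r = 2 := by omega
      rw [h6] at hs hmr hne
      rw [hmr] at hs ⊢
      omega
    · have h7 : 2 * (q * r) ≤ (q + 1) * (r + 1) := by
        rw [← hmr]; exact hs
      nlinarith

theorem np_core {n p m : ℕ} (hp : p.Prime) (hpm : ¬ p ∣ m) (hm : 0 < m) (hn : n = p * m)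
    {D : Finset ℕ} (hD : D ⊆ n.properDivisors) (hc : D.card ≤ 5)
    (hs : ArithmeticFunction.sigma 1 n = 2 * n + ∑ d ∈ D, d) :
    m = 6 ∨ ∃ E ⊆ m.divisors, E.card ≤ 5 ∧ ∑ d ∈ E, d < ArithmeticFunction.sigma 1 m ∧
      p ∣ ArithmeticFunction.sigma 1 m - ∑ d ∈ E, d := by
  have hcop : Nat.Coprime p m := (Nat.Prime.coprime_iff_not_dvd hp).2 hpm
  have hsig : ArithmeticFunction.sigma 1 n = (p + 1) * ArithmeticFunction.sigma 1 m := by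
    rw [hn, ArithmeticFunction.isMultiplicative_sigma.map_mul_of_coprime hcop, 
      ArithmeticFunction.sigma_one_apply p, hp.sum_divisors]
    
  set E := D.filter (fun d => ¬ p ∣ d) with hE
  have hsum : ∑ d ∈ D, d = ∑ d ∈ D.filter (fun d => p ∣ d), d + ∑ d ∈ E, d :=
    (Finset.sum_filter_add_sum_filter_not _ _ _).symm
  have hpdvd : p ∣ ∑ d ∈ D.filter (fun d => p ∣ d), d :=
    Finset.dvd_sum fun d hd => (Finset.mem_filter.1 hd).2
  have hEs : E ⊆ m.divisors := by
    intro d hd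
    rw [hE, Finset.mem_filter] at hd
    have h1 := (Nat.mem_properDivisors.1 (hD hd.1)).1
    rw [Nat.mem_divisors]
    refine ⟨?_, hm.ne'⟩
    rw [hn] at h1
    exact (Nat.Coprime.symm ((Nat.Prime.coprime_iff_not_dvd hp).2 hd.2)).dvd_of_dvd_mul_left h1
  have hEc : E.card ≤ 5 := (Finset.card_filter_le _ _).trans hc
  rw [hsig, hsum] at hs
  by_cases hEq : E = m.divisors
  · left
    apply np_six hm (hEq ▸ hEc)
    rw [hEq, ← ArithmeticFunction.sigma_one_apply] at hs
    have := hp.pos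
    rw [hn] at hs
    have : p * (2 * m) ≤ p * ArithmeticFunction.sigma 1 m := by
      have h0 := Nat.zero_le (∑ d ∈ D.filter (fun d => p ∣ d), d)
      generalize (∑ d ∈ D.filter (fun d => p ∣ d), d) = S at *
      generalize ArithmeticFunction.sigma 1 m = W at *
      nlinarith
    exact Nat.le_of_mul_le_mul_left this hp.pos
  · right
    have hlt : ∑ d ∈ E, d < ArithmeticFunction.sigma 1 m := by
      rw [ArithmeticFunction.sigma_one_apply]
      obtain ⟨y, hy, hy'⟩ := Finset.exists_of_ssubset (hEs.ssubset_of_ne hEq)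
      exact Finset.sum_lt_sum_of_subset hEs hy hy' (Nat.pos_of_mem_divisors hy) (fun _ _ _ => Nat.zero_le _)
    refine ⟨E, hEs, hEc, hlt, ?_⟩
    obtain ⟨c, hcc⟩ := hpdvd
    rw [hcc, hn] at hs
    generalize ∑ d ∈ E, d = S at *
    generalize ArithmeticFunction.sigma 1 m = W at *
    have h2 : (p:ℤ) ∣ ((W - S : ℕ) : ℤ) := by
      rw [Nat.cast_sub hlt.le]
      refine ⟨2 * m + c - W, ?_⟩
      zify at hs
      linarith
    exact_mod_cast h2

theorem np_lower {p : ℕ} (hp : p.Prime) (h3 : 3 < p) : ∃ D ⊆ (6 * p).properDivisors,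
    D.card ≤ 4 ∧ ArithmeticFunction.sigma 1 (6 * p) = 2 * (6 * p) + ∑ d ∈ D, d := by
  refine ⟨{1, 2, 3, 6}, ?_, by decide, ?_⟩
  · intro y
    simp only [Finset.mem_insert, Finset.mem_singleton, Nat.mem_properDivisors]
    rintro (rfl | rfl | rfl | rfl) <;> constructor <;> first | omega
  · have hcop : Nat.Coprime 6 p := by
      rw [Nat.coprime_comm, Nat.Prime.coprime_iff_not_dvd hp]
      intro h
      have := Nat.le_of_dvd (by norm_num) h
      interval_cases p <;> revert hp h <;> decide
    rw [ArithmeticFunction.isMultiplicative_sigma.map_mul_of_coprime hcop,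
      ArithmeticFunction.sigma_one_apply p, hp.sum_divisors]
    have : ArithmeticFunction.sigma 1 6 = 12 := by decide
    rw [this]
    simp
    ring

end

section

open Finset

theorem np_tau (X T : ℕ) :
    (((Icc 1 X).filter (fun n => T < n.divisors.card)).card : ℝ) * T ≤ X * (1 + Real.log X) := by
  have h1 : ((Icc 1 X).filter (fun n => T < n.divisors.card)).card * T
      ≤ ∑ n ∈ Ioc 0 X, X / n := by
    rw [← ArithmeticFunction.sum_Ioc_sigma0_eq_sum_div]
    calc _ = ∑ n ∈ (Icc 1 X).filter (fun n => T < n.divisors.card), T := by simp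
      _ ≤ ∑ n ∈ (Icc 1 X).filter (fun n => T < n.divisors.card), ArithmeticFunction.sigma 0 n := by
        apply Finset.sum_le_sum
        intro n hn
        rw [ArithmeticFunction.sigma_zero_apply]
        exact (Finset.mem_filter.1 hn).2.le
      _ ≤ _ := by
        apply Finset.sum_le_sum_of_subset
        intro n hn
        simp at hn ⊢
        omega
  have h2 : (∑ n ∈ Ioc 0 X, X / n : ℕ) ≤ (X : ℝ) * (harmonic X : ℝ) := by
    rw [harmonic_eq_sum_Icc]
    push_cast
    rw [Finset.mul_sum]
    apply Finset.sum_le_sum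
    intro n hn
    rw [← div_eq_mul_inv]
    exact Nat.cast_div_le
  have h3 := harmonic_le_one_add_log X
  have h4 : ((((Icc 1 X).filter (fun n => T < n.divisors.card)).card * T : ℕ) : ℝ) ≤
      (∑ n ∈ Ioc 0 X, X / n : ℕ) := by exact_mod_cast h1
  push_cast at h4 h2
  calc _ ≤ _ := h4
    _ ≤ _ := h2
    _ ≤ _ := by gcongr

open Classical in
theorem np_sq (X N : ℕ) (hN : 1 ≤ N) :
    (((Icc 1 X).filter (fun n => ∃ p, N ≤ p ∧ p ^ 2 ∣ n)).card : ℝ) ≤ X * (2 / N) := by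
  have h1 : ((Icc 1 X).filter (fun n => ∃ p, N ≤ p ∧ p ^ 2 ∣ n)) ⊆
      (Ioo (N - 1) (X + 1)).biUnion (fun p => (Ioc 0 X).filter (fun n => p ^ 2 ∣ n)) := by
    intro n hn
    simp only [mem_filter, mem_Icc, mem_biUnion, mem_Ioo, mem_Ioc] at hn ⊢
    obtain ⟨hn1, p, hp, hpn⟩ := hn
    have h2 := Nat.le_of_dvd (by omega) hpn
    have h3 : p ≤ p ^ 2 := Nat.le_self_pow (by norm_num) p
    exact ⟨p, ⟨by omega, by omega⟩, ⟨by omega, by omega⟩, hpn⟩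
  have h2 := (Finset.card_le_card h1).trans Finset.card_biUnion_le
  have h3 : (((Icc 1 X).filter (fun n => ∃ p, N ≤ p ∧ p ^ 2 ∣ n)).card : ℝ) ≤
      ∑ p ∈ Ioo (N - 1) (X + 1), (X : ℝ) * ((p:ℝ) ^ 2)⁻¹ := by
    refine (Nat.cast_le.2 h2).trans ?_
    push_cast
    apply Finset.sum_le_sum
    intro p hp
    rw [Nat.Ioc_filter_dvd_card_eq_div, ← div_eq_mul_inv]
    refine Nat.cast_div_le.trans ?_
    push_cast; rfl
  refine h3.trans ?_
  rw [← Finset.mul_sum]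
  gcongr
  have := sum_Ioo_inv_sq_le (α := ℝ) (N - 1) (X + 1)
  rwa [Nat.cast_sub hN, Nat.cast_one, sub_add_cancel] at this

theorem np_subsets (s : Finset ℕ) (T : ℕ) (hT : 1 ≤ T) (hs : s.card ≤ T) :
    (s.powerset.filter (fun E => E.card ≤ 5)).card ≤ 6 * T ^ 5 := by
  have h1 : s.powerset.filter (fun E => E.card ≤ 5) ⊆
      (range 6).biUnion (fun i => s.powersetCard i) := by
    intro E hE
    simp only [mem_filter, mem_powerset, mem_biUnion, mem_range, mem_powersetCard] at hE ⊢
    exact ⟨E.card, by omega, hE.1, rfl⟩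
  refine ((Finset.card_le_card h1).trans Finset.card_biUnion_le).trans ?_
  calc _ ≤ ∑ i ∈ range 6, T ^ 5 := by
        apply Finset.sum_le_sum
        intro i hi
        rw [Finset.card_powersetCard]
        refine (Nat.choose_le_pow _ _).trans ?_
        refine (Nat.pow_le_pow_left hs i).trans ?_
        exact Nat.pow_le_pow_right hT (by simp at hi; omega)
    _ = _ := by simp

theorem np_omega (v : ℕ) (hv : v ≠ 0) : 2 ^ v.primeFactors.card ≤ v := by
  calc 2 ^ v.primeFactors.card = ∏ p ∈ v.primeFactors, 2 := by simp
    _ ≤ ∏ p ∈ v.primeFactors, p := by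
      apply Finset.prod_le_prod'
      intro p hp
      exact (Nat.prime_of_mem_primeFactors hp).two_le
    _ ≤ v := Nat.le_of_dvd (Nat.pos_of_ne_zero hv) (Nat.prod_primeFactors_dvd v)

theorem np_omega_log (v X : ℕ) (hX : 1 ≤ X) (hv : v ≤ X ^ 2) : (v.primeFactors.card : ℝ) ≤ 4 * Real.log X := by
  have hX' : (1:ℝ) ≤ X := by exact_mod_cast hX
  rcases eq_or_ne v 0 with rfl | h0
  · simp [Real.log_nonneg hX']
  have h1 : (2:ℝ) ^ v.primeFactors.card ≤ (X:ℝ) ^ 2 := by exact_mod_cast (np_omega v h0).trans hv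
  have h2 := Real.log_le_log (by positivity) h1
  rw [Real.log_pow, Real.log_pow] at h2
  have h3 := Real.log_two_gt_d9
  push_cast at h2
  have h4 : (0:ℝ) ≤ v.primeFactors.card := by positivity
  nlinarith

def npB (X N T : ℕ) : Finset ℕ :=
  ((Icc 1 (X / N)).filter (fun m => m.divisors.card ≤ T)).biUnion fun m =>
    (m.divisors.powerset.filter (fun E => E.card ≤ 5)).biUnion fun E =>
      ((ArithmeticFunction.sigma 1 m - ∑ d ∈ E, d).primeFactors).image (· * m)

theorem np_sigma_le (m : ℕ) : ArithmeticFunction.sigma 1 m ≤ m ^ 2 := by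
  rw [ArithmeticFunction.sigma_one_apply, sq]
  calc _ ≤ ∑ d ∈ m.divisors, m := Finset.sum_le_sum fun d hd => Nat.divisor_le hd
    _ = m.divisors.card * m := by simp
    _ ≤ _ := Nat.mul_le_mul_right _ (Nat.card_divisors_le_self m)

theorem np_B_card (X N T : ℕ) (hX : 1 ≤ X) (hT : 1 ≤ T) :
    ((npB X N T).card : ℝ) ≤ (X / N : ℝ) * ((6 * T ^ 5) * (4 * Real.log X)) := by
  have hX' : (1:ℝ) ≤ X := by exact_mod_cast hX
  have hL := Real.log_nonneg hX'
  unfold npB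
  refine (Nat.cast_le.2 Finset.card_biUnion_le).trans ?_
  push_cast
  calc _ ≤ ∑ m ∈ (Icc 1 (X / N)).filter (fun m => m.divisors.card ≤ T), (6 * (T:ℝ) ^ 5) * (4 * Real.log X) := by
        apply Finset.sum_le_sum
        intro m hm
        simp only [mem_filter, mem_Icc] at hm
        refine (Nat.cast_le.2 Finset.card_biUnion_le).trans ?_
        push_cast
        calc _ ≤ ∑ E ∈ m.divisors.powerset.filter (fun E => E.card ≤ 5), 4 * Real.log X := by
              apply Finset.sum_le_sum
              intro E hE
              refine (Nat.cast_le.2 Finset.card_image_le).trans ?_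
              apply np_omega_log _ _ hX
              refine (Nat.sub_le _ _).trans ((np_sigma_le m).trans ?_)
              exact Nat.pow_le_pow_left (hm.1.2.trans (Nat.div_le_self _ _)) 2
          _ ≤ _ := by
              rw [Finset.sum_const, nsmul_eq_mul]
              have := np_subsets m.divisors T hT hm.2
              have h5 : ((m.divisors.powerset.filter (fun E => E.card ≤ 5)).card : ℝ) ≤ 6 * (T:ℝ) ^ 5 := by
                exact_mod_cast this
              gcongr
    _ ≤ _ := by
      rw [Finset.sum_const, nsmul_eq_mul]
      gcongr
      calc _ ≤ (((X / N : ℕ)) : ℝ) := by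
            refine Nat.cast_le.2 ((Finset.card_filter_le _ _).trans ?_)
            simp
        _ ≤ _ := Nat.cast_div_le

open Classical in
theorem np_cover (X N T : ℕ) (hN : 1 ≤ N) :
    (Finset.Icc 1 X).filter (fun n => ∃ D ⊆ n.properDivisors,
          D.card ≤ 5 ∧ ArithmeticFunction.sigma 1 n = 2 * n + ∑ d ∈ D, d) ⊆
      ((Icc 1 (X / 6)).filter Nat.Prime).image (6 * ·) ∪
      ((Icc 1 X).filter (fun n => n ∈ N.smoothNumbers) ∪
      ((Icc 1 X).filter (fun n => T < n.divisors.card) ∪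
      ((Icc 1 X).filter (fun n => ∃ p, N ≤ p ∧ p ^ 2 ∣ n) ∪ npB X N T))) := by
  intro n hn
  obtain ⟨hnX, D, hD, hDc, hs⟩ := Finset.mem_filter.1 hn
  rw [mem_union, mem_union, mem_union, mem_union, mem_filter, mem_filter, mem_filter]
  by_cases h1 : n ∈ N.smoothNumbers
  · exact Or.inr (Or.inl ⟨hnX, h1⟩)
  by_cases h2 : T < n.divisors.card
  · exact Or.inr (Or.inr (Or.inl ⟨hnX, h2⟩))
  by_cases h3 : ∃ p, N ≤ p ∧ p ^ 2 ∣ n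
  · exact Or.inr (Or.inr (Or.inr (Or.inl ⟨hnX, h3⟩)))
  have hnX' := mem_Icc.1 hnX
  rw [Nat.mem_smoothNumbers'] at h1
  push Not at h1 h3
  obtain ⟨p, hp, ⟨m, hm⟩, hpN⟩ := h1
  have hpm : ¬ p ∣ m := by
    rintro ⟨c, rfl⟩
    exact h3 p hpN ⟨c, by rw [hm]; ring⟩
  have hm0 : 0 < m := by
    rcases Nat.eq_zero_or_pos m with rfl | h
    · omega
    · exact h
  rcases np_core hp hpm hm0 hm hD hDc hs with h6 | ⟨E, hE, hEc, hlt, hdvd⟩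
  · left
    rw [mem_image]
    refine ⟨p, ?_, by subst h6; rw [hm]; ring⟩
    rw [mem_filter, mem_Icc]
    subst h6
    exact ⟨⟨hp.pos, by omega⟩, hp⟩
  · right; right; right; right
    unfold npB
    simp only [mem_biUnion, mem_filter, mem_Icc, mem_powerset, mem_image]
    refine ⟨m, ⟨⟨hm0, ?_⟩, ?_⟩, E, ⟨hE, hEc⟩, p, ?_, hm.symm⟩
    · rw [Nat.le_div_iff_mul_le hN]
      nlinarith
    · have : m.divisors ⊆ n.divisors := Nat.divisors_subset_of_dvd (by omega) ⟨p, by rw [hm]; ring⟩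
      have := Finset.card_le_card this
      omega
    · rw [Nat.mem_primeFactors]
      exact ⟨hp, hdvd, by omega⟩

theorem np_smooth (X N : ℕ) (hX : 1 ≤ X) (hN : 1 ≤ N) (δ : ℝ) (h0 : 0 < δ) (h1 : δ < 1 / 2) :
    (((Icc 1 X).filter (fun n => n ∈ N.smoothNumbers)).card : ℝ) ≤
      (X:ℝ) ^ (1 - δ) * Real.exp (4 * ((N:ℝ) ^ δ * (1 + Real.log N))) := by
  let f : ℕ →* ℝ :=
    { toFun := fun n => (n:ℝ) ^ (-(1 - δ))
      map_one' := by simp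
      map_mul' := by
        intro a b
        push_cast
        rw [Real.mul_rpow (by positivity) (by positivity)] }
  have hf : ∀ n : ℕ, f n = (n:ℝ) ^ (-(1 - δ)) := fun n => rfl
  have hfnn : ∀ n : ℕ, 0 ≤ f n := fun n => by rw [hf]; positivity
  have hf34 : ∀ p : ℕ, p.Prime → f p ≤ 3 / 4 := by
    intro p hp
    rw [hf]
    have hp2 : (2:ℝ) ≤ p := by exact_mod_cast hp.two_le
    calc (p:ℝ) ^ (-(1 - δ)) ≤ (p:ℝ) ^ (-(1/2 : ℝ)) := by
          apply Real.rpow_le_rpow_of_exponent_le <;> linarith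
      _ ≤ (2:ℝ) ^ (-(1/2 : ℝ)) := by
          apply Real.rpow_le_rpow_of_nonpos <;> linarith
      _ = (Real.sqrt 2)⁻¹ := by
          rw [Real.rpow_neg (by norm_num), ← Real.sqrt_eq_rpow]
      _ ≤ 3 / 4 := by
          rw [inv_le_comm₀ (by positivity) (by norm_num)]
          apply Real.le_sqrt_of_sq_le
          norm_num
  obtain ⟨hsm, hhs⟩ := EulerProduct.summable_and_hasSum_smoothNumbers_prod_primesBelow_geometric
    (f := f) (fun {p} hp => by
      rw [Real.norm_of_nonneg (hfnn p)]; linarith [hf34 p hp]) N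
  have hX' : (0:ℝ) < X := by exact_mod_cast hX
  have hsum : ∑ n ∈ (Icc 1 X).filter (fun n => n ∈ N.smoothNumbers), f n ≤
      ∏ p ∈ N.primesBelow, (1 - f p)⁻¹ := by
    have := sum_le_hasSum ((Icc 1 X).subtype (fun n => n ∈ N.smoothNumbers))
      (fun i _ => hfnn i) hhs
    refine le_trans (le_of_eq ?_) this
    rw [Finset.sum_subtype_eq_sum_filter]
  have hcount : (((Icc 1 X).filter (fun n => n ∈ N.smoothNumbers)).card : ℝ) ≤
      (X:ℝ) ^ (1 - δ) * ∑ n ∈ (Icc 1 X).filter (fun n => n ∈ N.smoothNumbers), f n := by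
    rw [Finset.mul_sum, Finset.card_eq_sum_ones]
    push_cast
    apply Finset.sum_le_sum
    intro n hn
    obtain ⟨hn1, hn2⟩ := mem_Icc.1 (mem_filter.1 hn).1
    rw [hf, Real.rpow_neg (by positivity), ← div_eq_mul_inv, ← Real.div_rpow (by positivity) (by positivity)]
    apply Real.one_le_rpow _ (by linarith)
    rw [le_div_iff₀ (by exact_mod_cast hn1), one_mul]
    exact_mod_cast hn2
  refine hcount.trans (mul_le_mul_of_nonneg_left (hsum.trans ?_) (by positivity))
  calc ∏ p ∈ N.primesBelow, (1 - f p)⁻¹ ≤ ∏ p ∈ N.primesBelow, Real.exp (4 * f p) := by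
        apply Finset.prod_le_prod
        · intro p hp
          have := hf34 p (Nat.prime_of_mem_primesBelow hp)
          apply inv_nonneg.2; linarith
        · intro p hp
          have h2 := hf34 p (Nat.prime_of_mem_primesBelow hp)
          have h3 := hfnn p
          refine le_trans ?_ (Real.add_one_le_exp _)
          rw [inv_le_comm₀ (by linarith) (by linarith)]
          rw [inv_le_comm₀ (by linarith) (by linarith)]
          rw [← one_div, div_le_iff₀ (by linarith)]
          nlinarith
    _ = Real.exp (4 * ∑ p ∈ N.primesBelow, f p) := by
        rw [Finset.mul_sum, Real.exp_sum]
    _ ≤ _ := by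
        apply Real.exp_le_exp.2
        gcongr
        calc ∑ p ∈ N.primesBelow, f p ≤ ∑ p ∈ Icc 1 N, f p := by
              apply Finset.sum_le_sum_of_subset_of_nonneg
              · intro p hp
                have h2 := (Nat.prime_of_mem_primesBelow hp).pos
                have h3 := Nat.lt_of_mem_primesBelow hp
                rw [mem_Icc]; omega
              · intros; exact hfnn _
          _ ≤ ∑ n ∈ Icc 1 N, (N:ℝ) ^ δ * ((n:ℝ))⁻¹ := by
              apply Finset.sum_le_sum
              intro n hn
              obtain ⟨hn1, hn2⟩ := mem_Icc.1 hn
              have hn0 : (0:ℝ) < n := by exact_mod_cast hn1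
              rw [hf, neg_sub, Real.rpow_sub hn0, Real.rpow_one, div_eq_mul_inv]
              gcongr
          _ = (N:ℝ) ^ δ * (harmonic N : ℝ) := by
              rw [harmonic_eq_sum_Icc, ← Finset.mul_sum]
              push_cast; rfl
          _ ≤ _ := by
              gcongr
              exact harmonic_le_one_add_log N

end

section

open Finset Filter Topology

theorem np_pc (Y : ℕ) : ((Icc 1 Y).filter Nat.Prime).card = Nat.primeCounting Y := by
  rw [Nat.primeCounting, Nat.primeCounting', Nat.count_eq_card_filter_range]
  congr 1
  ext p
  simp only [mem_filter, mem_Icc, mem_range]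
  constructor
  · rintro ⟨h, hp⟩; exact ⟨by omega, hp⟩
  · rintro ⟨h, hp⟩; exact ⟨⟨hp.pos, by omega⟩, hp⟩

open Classical in
noncomputable def npC (k X : ℕ) : ℕ := ((Finset.Icc 1 X).filter (fun n => ∃ D ⊆ n.properDivisors,
          D.card ≤ k ∧ ArithmeticFunction.sigma 1 n = 2 * n + ∑ d ∈ D, d)).card

theorem np_lower_count (k X : ℕ) (hk : 4 ≤ k) :
    Nat.primeCounting (X / 6) ≤ npC k X + 2 := by
  classical
  have h1 : ((((Icc 1 (X / 6)).filter Nat.Prime) \ {2, 3}).image (6 * ·)) ⊆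
      (Finset.Icc 1 X).filter (fun n => ∃ D ⊆ n.properDivisors,
          D.card ≤ k ∧ ArithmeticFunction.sigma 1 n = 2 * n + ∑ d ∈ D, d) := by
    intro n hn
    simp only [Finset.mem_image, Finset.mem_sdiff, Finset.mem_filter, Finset.mem_Icc, Finset.mem_insert, Finset.mem_singleton] at hn
    obtain ⟨p, ⟨⟨hp1, hp⟩, hp2⟩, rfl⟩ := hn
    have hp3 := hp.two_le
    obtain ⟨D, hD, hc, hs⟩ := np_lower hp (by omega)
    rw [mem_filter, mem_Icc]
    exact ⟨by omega, D, hD, hc.trans hk, hs⟩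
  have h2 := Finset.card_le_card h1
  rw [Finset.card_image_of_injective _ (fun a b h => by simpa using h)] at h2
  have h3 := Finset.le_card_sdiff ({2, 3} : Finset ℕ) ((Icc 1 (X / 6)).filter Nat.Prime)
  rw [np_pc] at h3
  have h4 : ({2, 3} : Finset ℕ).card = 2 := by decide
  have h5 : npC k X = _ := rfl
  unfold npC at h5 ⊢
  convert_to _ ≤ ((Finset.Icc 1 X).filter (fun n => ∃ D ⊆ n.properDivisors,
          D.card ≤ k ∧ ArithmeticFunction.sigma 1 n = 2 * n + ∑ d ∈ D, d)).card + 2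
  omega

theorem np_upper_count (k X N T : ℕ) (hk : k ≤ 5) (hX : 1 ≤ X) (hN : 1 ≤ N) (hT : 1 ≤ T)
    (δ : ℝ) (h0 : 0 < δ) (h1 : δ < 1 / 2) :
    (npC k X : ℝ) ≤ Nat.primeCounting (X / 6) +
      ((X:ℝ) ^ (1 - δ) * Real.exp (4 * ((N:ℝ) ^ δ * (1 + Real.log N))) +
      (X * (1 + Real.log X) / T + (X * (2 / N) + 
        (X / N : ℝ) * ((6 * T ^ 5) * (4 * Real.log X))))) := by
  classical
  have hT' : (0:ℝ) < T := by exact_mod_cast hT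
  have e1 := np_smooth X N hX hN δ h0 h1
  have e2 := np_tau X T
  rw [← le_div_iff₀ hT'] at e2
  have e3 := np_sq X N hN
  have e4 := np_B_card X N T hX hT
  have e5 := np_cover X N T hN
  have e6 := Finset.card_le_card e5
  have e60 : npC k X ≤ ((Finset.Icc 1 X).filter (fun n => ∃ D ⊆ n.properDivisors,
          D.card ≤ 5 ∧ ArithmeticFunction.sigma 1 n = 2 * n + ∑ d ∈ D, d)).card := by
    unfold npC
    apply Finset.card_le_card
    intro n
    simp only [mem_filter]
    rintro ⟨h, D, hD, hc, hs⟩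
    exact ⟨h, D, hD, hc.trans hk, hs⟩
  have e7 := (e60.trans (by convert e6)).trans ((Finset.card_union_le _ _).trans (Nat.add_le_add (Finset.card_image_le.trans (np_pc _).le)
    ((Finset.card_union_le _ _).trans (Nat.add_le_add_left
    ((Finset.card_union_le _ _).trans (Nat.add_le_add_left (Finset.card_union_le _ _) _)) _))))
  refine (Nat.cast_le.2 e7).trans ?_
  push_cast
  refine add_le_add_right (add_le_add ?_ (add_le_add ?_ (add_le_add ?_ e4))) _
  · convert e1
  · convert e2
  · convert e3

noncomputable def npErr (L : ℝ) : ℝ :=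
  L * (Real.exp (-L / 42) * Real.exp (4 * (L ^ (1/2:ℝ) * (1 + 21 * Real.log L)))) +
    (L * ((1 + L) / L ^ 3) + (L * (2 / L ^ 20) + 768 / L ^ 3))

theorem np_G_tendsto : Tendsto npErr atTop (𝓝 0) := by
  unfold npErr
  have hinv : Tendsto (fun L : ℝ => L⁻¹) atTop (𝓝 0) := tendsto_inv_atTop_zero
  have hpow : ∀ n : ℕ, n ≠ 0 → Tendsto (fun L : ℝ => (L⁻¹) ^ n) atTop (𝓝 0) := by
    intro n hn
    simpa [hn] using hinv.pow n
  rw [show (0:ℝ) = 0 + ((0 + 0) + (2 * 0 + 768 * 0)) by norm_num]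
  refine Tendsto.add ?_ (Tendsto.add ?_ (Tendsto.add ?_ ?_))
  · have h1 : Tendsto (fun L : ℝ => Real.log L / L ^ (1:ℝ)) atTop (𝓝 0) :=
      (isLittleO_log_rpow_atTop one_pos).tendsto_div_nhds_zero
    have h2 : Tendsto (fun L : ℝ => Real.log L / L ^ (1/2:ℝ)) atTop (𝓝 0) :=
      (isLittleO_log_rpow_atTop (by norm_num)).tendsto_div_nhds_zero
    have h3 : Tendsto (fun L : ℝ => (L ^ (1/2:ℝ))⁻¹) atTop (𝓝 0) :=
      (tendsto_rpow_atTop (by norm_num)).inv_tendsto_atTop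
    have h4 : Tendsto (fun L : ℝ => Real.log L / L ^ (1:ℝ) + (-(1/42) +
        4 * ((L ^ (1/2:ℝ))⁻¹ + 21 * (Real.log L / L ^ (1/2:ℝ))))) atTop
        (𝓝 (0 + (-(1/42) + 4 * (0 + 21 * 0)))) :=
      h1.add ((h3.add (h2.const_mul _)).const_mul _ |>.const_add _)
    have h5 := Tendsto.atTop_mul_neg (by norm_num) tendsto_id h4
    refine (Real.tendsto_exp_atBot.comp h5).congr' ?_
    filter_upwards [eventually_gt_atTop 0] with L hL
    simp only [Function.comp, id]
    have hs : L ^ (1/2:ℝ) * L ^ (1/2:ℝ) = L := by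
      rw [← Real.rpow_add hL]; norm_num
    have hsp : 0 < L ^ (1/2:ℝ) := by positivity
    have hmul : ∀ y : ℝ, L * Real.exp y = Real.exp (Real.log L + y) := by
      intro y
      rw [Real.exp_add, Real.exp_log hL]
    rw [← Real.exp_add, hmul, Real.rpow_one]
    congr 1
    generalize L ^ (1/2:ℝ) = s at *
    generalize Real.log L = l at *
    subst hs
    field_simp
  · have : Tendsto (fun L : ℝ => (L⁻¹) ^ 2 + (L⁻¹) ^ 1) atTop (𝓝 (0 + 0)) :=
      (hpow 2 (by norm_num)).add (hpow 1 (by norm_num))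
    rw [add_zero] at this
    refine (this.congr' ?_).trans (by simp)
    filter_upwards [eventually_gt_atTop 0] with L hL
    field_simp
  · refine ((hpow 19 (by norm_num)).const_mul 2).congr' ?_
    filter_upwards [eventually_gt_atTop 0] with L hL
    field_simp
  · refine ((hpow 3 (by norm_num)).const_mul 768).congr' ?_
    filter_upwards [eventually_gt_atTop 0] with L hL
    field_simp

theorem np_upper_real (k : ℕ) (hk : k ≤ 5) (x : ℝ) (hx : 1 < x) (hL : 2 ≤ Real.log x) :
    (npC k ⌊x⌋₊ : ℝ) ≤ Nat.primeCounting (⌊x⌋₊ / 6) + x / Real.log x * npErr (Real.log x) := by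
  set L := Real.log x with hLd
  set X := ⌊x⌋₊ with hXd
  have hx0 : 0 < x := by linarith
  have hX1 : 1 ≤ X := Nat.le_floor (by simpa using hx.le)
  have hXx : (X:ℝ) ≤ x := Nat.floor_le hx0.le
  have hX0 : (0:ℝ) < X := by exact_mod_cast hX1
  have hlogX : Real.log X ≤ L := Real.log_le_log hX0 hXx
  have hlogX0 : 0 ≤ Real.log X := Real.log_natCast_nonneg _
  have hL0 : 0 < L := by linarith
  set N := ⌈L ^ 20⌉₊ with hNd
  set T := ⌈L ^ 3⌉₊ with hTd
  have hN1 : L ^ 20 ≤ N := Nat.le_ceil _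
  have hT1 : L ^ 3 ≤ T := Nat.le_ceil _
  have p20 : (1:ℝ) ≤ L ^ 20 := one_le_pow₀ (by linarith)
  have p3 : (1:ℝ) ≤ L ^ 3 := one_le_pow₀ (by linarith)
  have hN2 : (N:ℝ) ≤ L ^ 21 := by
    have := (Nat.ceil_lt_add_one (show (0:ℝ) ≤ L ^ 20 by positivity)).le
    have h2 : L ^ 20 * 2 ≤ L ^ 20 * L := by gcongr
    have h3 : L ^ 21 = L ^ 20 * L := by ring
    linarith
  have hT2 : (T:ℝ) ≤ 2 * L ^ 3 := by
    have := (Nat.ceil_lt_add_one (show (0:ℝ) ≤ L ^ 3 by positivity)).le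
    linarith
  have hNp : (0:ℝ) < N := by linarith
  have hTp : (0:ℝ) < T := by linarith
  have hN : 1 ≤ N := by exact_mod_cast hNp
  have hT : 1 ≤ T := by exact_mod_cast hTp
  refine (np_upper_count k X N T hk hX1 hN hT (1/42) (by norm_num) (by norm_num)).trans ?_
  refine add_le_add_right ?_ _
  have hNlog : Real.log N ≤ 21 * Real.log L := by
    have := Real.log_le_log hNp hN2
    rwa [Real.log_pow] at this
  have hNlog0 : 0 ≤ Real.log N := Real.log_natCast_nonneg _
  have hNd : (N:ℝ) ^ (1/42:ℝ) ≤ L ^ (1/2:ℝ) := by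
    calc (N:ℝ) ^ (1/42:ℝ) ≤ (L ^ 21) ^ (1/42:ℝ) := by gcongr
      _ = _ := by
        rw [← Real.rpow_natCast, ← Real.rpow_mul hL0.le]; norm_num
  have hXp : (X:ℝ) ^ (1 - 1/42:ℝ) ≤ x * Real.exp (-L / 42) := by
    calc (X:ℝ) ^ (1 - 1/42:ℝ) ≤ x ^ (1 - 1/42:ℝ) := by
          apply Real.rpow_le_rpow <;> first | positivity | linarith
      _ = _ := by
        rw [Real.rpow_sub hx0, Real.rpow_one, Real.rpow_def_of_pos hx0, ← hLd, div_eq_mul_inv, ← Real.exp_neg]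
        congr 2; ring
  have b1 : (X:ℝ) ^ (1 - 1/42:ℝ) * Real.exp (4 * ((N:ℝ) ^ (1/42:ℝ) * (1 + Real.log N))) ≤
      x * Real.exp (-L / 42) * Real.exp (4 * (L ^ (1/2:ℝ) * (1 + 21 * Real.log L))) := by
    gcongr
  have b2 : X * (1 + Real.log X) / T ≤ x * (1 + L) / L ^ 3 := by gcongr
  have b3 : X * (2 / (N:ℝ)) ≤ x * (2 / L ^ 20) := by gcongr
  have b4 : (X / N : ℝ) * ((6 * T ^ 5) * (4 * Real.log X)) ≤ (x / L ^ 20) * ((6 * (2 * L ^ 3) ^ 5) * (4 * L)) := by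
    gcongr
  refine (add_le_add b1 (add_le_add b2 (add_le_add b3 b4))).trans (le_of_eq ?_)
  unfold npErr
  field_simp
  ring

theorem np_main (k : ℕ) (hk : 4 ≤ k) (hk' : k ≤ 5) :
    Tendsto (fun x : ℝ => (npC k ⌊x⌋₊ : ℝ) / ((1 / 6) * x / Real.log x)) atTop (𝓝 1) := by
  have hfl : ∀ x : ℝ, ⌊x⌋₊ / 6 = ⌊x / 6⌋₊ := by
    intro x
    have := Nat.floor_div_natCast x 6
    rw [← this]; norm_num
  have hx6 : Tendsto (fun x : ℝ => x / 6) atTop atTop := tendsto_id.atTop_div_const (by norm_num)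
  have h1 := np_pnt.comp hx6
  have hlog := Real.tendsto_log_atTop
  have hr : Tendsto (fun x : ℝ => (1 - Real.log 6 * (Real.log x)⁻¹)⁻¹) atTop (𝓝 1) := by
    have := ((tendsto_inv_atTop_zero.comp hlog).const_mul (Real.log 6)).const_sub 1
    simp only [mul_zero, sub_zero] at this
    simpa using this.inv₀ one_ne_zero
  have hP : Tendsto (fun x : ℝ => (Nat.primeCounting (⌊x⌋₊ / 6) : ℝ) / ((1 / 6) * x / Real.log x))
      atTop (𝓝 1) := by
    have h2 := h1.mul hr
    rw [one_mul] at h2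
    refine h2.congr' ?_
    filter_upwards [eventually_gt_atTop 6, hlog.eventually_gt_atTop (Real.log 6)] with x hx hl
    simp only [Function.comp]
    rw [hfl, Real.log_div (by linarith) (by norm_num)]
    have h6 : 0 < Real.log 6 := Real.log_pos (by norm_num)
    have hl0 : 0 < Real.log x := by linarith
    have hd : Real.log x - Real.log 6 ≠ 0 := by linarith
    have : 1 - Real.log 6 * (Real.log x)⁻¹ = (Real.log x - Real.log 6) / Real.log x := by
      field_simp
    rw [this]
    field_simp
  have hlo : Tendsto (fun x : ℝ => (Nat.primeCounting (⌊x⌋₊ / 6) : ℝ) / ((1 / 6) * x / Real.log x) - 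
      12 * (Real.log x / x)) atTop (𝓝 1) := by
    have h3 : Tendsto (fun x : ℝ => Real.log x / x ^ (1:ℝ)) atTop (𝓝 0) :=
      (isLittleO_log_rpow_atTop one_pos).tendsto_div_nhds_zero
    simp only [Real.rpow_one] at h3
    simpa using hP.sub (h3.const_mul 12)
  have hup : Tendsto (fun x : ℝ => (Nat.primeCounting (⌊x⌋₊ / 6) : ℝ) / ((1 / 6) * x / Real.log x) + 
      6 * npErr (Real.log x)) atTop (𝓝 1) := by
    simpa using hP.add ((np_G_tendsto.comp hlog).const_mul 6)
  refine tendsto_of_tendsto_of_tendsto_of_le_of_le' hlo hup ?_ ?_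
  · filter_upwards [eventually_gt_atTop 1] with x hx
    have hl := Real.log_pos hx
    have := np_lower_count k ⌊x⌋₊ hk
    have h4 : (Nat.primeCounting (⌊x⌋₊ / 6) : ℝ) - 2 ≤ npC k ⌊x⌋₊ := by
      rw [sub_le_iff_le_add]; exact_mod_cast this
    calc _ = ((Nat.primeCounting (⌊x⌋₊ / 6) : ℝ) - 2) / ((1 / 6) * x / Real.log x) := by
          have : x ≠ 0 := by linarith
          field_simp
          ring
      _ ≤ _ := by gcongr
  · filter_upwards [eventually_gt_atTop 1, hlog.eventually_ge_atTop 2] with x hx hL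
    have hl := Real.log_pos hx
    have := np_upper_real k hk' x hx hL
    calc _ ≤ (Nat.primeCounting (⌊x⌋₊ / 6) + x / Real.log x * npErr (Real.log x)) / ((1 / 6) * x / Real.log x) := by gcongr
      _ = _ := by
          have : x ≠ 0 := by linarith
          field_simp

end

open Classical in
theorem near_perfect_four_five_asymptotic (k : ℕ) (hk : 4 ≤ k) (hk' : k ≤ 5) :
    Filter.Tendsto (fun x : ℝ =>
      (((Finset.Icc 1 ⌊x⌋₊).filter (fun n => ∃ D ⊆ n.properDivisors,
          D.card ≤ k ∧ ArithmeticFunction.sigma 1 n = 2 * n + ∑ d ∈ D, d)).card : ℝ) /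
        ((1 / 6) * x / Real.log x))
      Filter.atTop (nhds 1) := by
  have h := np_main k hk hk'
  unfold npC at h
  convert h
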